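/- For every n ≥ 3 and every 0 < i < n-1, the commutative square with top map d_1⋯d_i : X_n → X_{n-i}, left map d_{i+2}⋯d_n : X_n → X_{i+1}, right map d_2⋯d_{n-i} : X_{n-i} → X_1, and bottom map d_1⋯d_i : X_{i+1} → X_1 is a pullback square of sets, where X = X^T is the simplicial set of layered admissible subforests of a rooted tree T. -/

import Mathlib

/-- A finite rooted tree, encoded as a finite partial order with a least element
(the root) in which the set of elements below any given vertex is totally
ordered.  Edges of the tree are the covering pairs of the order. -/
structure CutTree where
  V : Type
  [fintypeV : Fintype V]
  [decEq : DecidableEq V]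
  [po : PartialOrder V]
  root : V
  root_le : ∀ v : V, root ≤ v
  lower_total : ∀ v a b : V, a ≤ v → b ≤ v → a ≤ b ∨ b ≤ a

attribute [instance] CutTree.fintypeV CutTree.decEq CutTree.po

namespace CutTree

variable (T : CutTree)

/-- A subset of the vertices defines a lower subtree when it is downward closed. -/
def IsLower (L : Set T.V) : Prop := ∀ ⦃a b : T.V⦄, a ≤ b → b ∈ L → a ∈ L

/-- `L` defines a lower subforest of the admissible subforest with vertex set `H`. -/
def IsLowerIn (H L : Set T.V) : Prop :=
  L ⊆ H ∧ ∀ ⦃a b : T.V⦄, a ∈ H → b ∈ L → a ≤ b → a ∈ L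

/-- `H` is the vertex set of an admissible subforest: a difference of two nested
downward closed sets. -/
def IsAdmissible (H : Set T.V) : Prop :=
  ∃ A B : Set T.V, T.IsLower A ∧ T.IsLower B ∧ B ⊆ A ∧ H = A \ B

theorem isLower_empty : T.IsLower (∅ : Set T.V) := fun _ _ _ h => h.elim

theorem isAdmissible_empty : T.IsAdmissible (∅ : Set T.V) :=
  ⟨∅, ∅, T.isLower_empty, T.isLower_empty, le_rfl, by simp⟩

/-- An `n`-simplex of the 2-Segal set `X^T`: an admissible subforest `H = L 0`
together with a layering of cuts `H = L 0 ⊇ L 1 ⊇ ⋯ ⊇ L n = ∅` by lower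
subforests of `H`. -/
@[ext]
structure Simplex (T : CutTree) (n : ℕ) where
  L : Fin (n + 1) → Set T.V
  admissible : T.IsAdmissible (L 0)
  antitone : Antitone L
  lowerIn : ∀ i, T.IsLowerIn (L 0) (L i)
  last_eq : L (Fin.last n) = ∅

theorem isAdmissible_diff {H P Q : Set T.V} (hH : T.IsAdmissible H)
    (hP : T.IsLowerIn H P) (hQ : T.IsLowerIn H Q) (hQP : Q ⊆ P) :
    T.IsAdmissible (P \ Q) := by
  obtain ⟨A, B, hA, hB, hBA, rfl⟩ := hH
  have hlow : ∀ R : Set T.V, T.IsLowerIn (A \ B) R → T.IsLower (R ∪ B) := by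
    rintro R ⟨hRsub, hRcl⟩ a b hab hb
    rcases hb with hb | hb
    · have hbA : b ∈ A := (hRsub hb).1
      have haA : a ∈ A := hA hab hbA
      by_cases haB : a ∈ B
      · exact Or.inr haB
      · exact Or.inl (hRcl ⟨haA, haB⟩ hb hab)
    · exact Or.inr (hB hab hb)
  refine ⟨P ∪ B, Q ∪ B, hlow P hP, hlow Q hQ, Set.union_subset_union_left _ hQP, ?_⟩
  ext x
  constructor
  · rintro ⟨hxP, hxQ⟩
    have hxB : x ∉ B := (hP.1 hxP).2
    exact ⟨Or.inl hxP, by rintro (h | h) <;> [exact hxQ h; exact hxB h]⟩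
  · rintro ⟨hx1, hx2⟩
    rcases hx1 with hx1 | hx1
    · exact ⟨hx1, fun h => hx2 (Or.inl h)⟩
    · exact absurd (Or.inr hx1) hx2

/-- The action of a simplicial operator `α : [m] → [n]` on `X^T`. -/
def act {m n : ℕ} (α : Fin (m + 1) → Fin (n + 1)) (hα : Monotone α)
    (σ : T.Simplex n) : T.Simplex m where
  L j := σ.L (α j) \ σ.L (α (Fin.last m))
  admissible := by
    refine T.isAdmissible_diff σ.admissible (σ.lowerIn _) (σ.lowerIn _) ?_
    exact σ.antitone (hα (Fin.le_last _))
  antitone := by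
    intro j k hjk
    exact Set.diff_subset_diff_left (σ.antitone (hα hjk))
  lowerIn := by
    intro i
    constructor
    · exact Set.diff_subset_diff_left (σ.antitone (hα (Fin.zero_le _)))
    · rintro a b ⟨haL, haS⟩ ⟨hbL, _⟩ hab
      have ha0 : a ∈ σ.L 0 := (σ.lowerIn (α 0)).1 haL
      exact ⟨(σ.lowerIn (α i)).2 ha0 hbL hab, haS⟩
  last_eq := Set.diff_self

/-- The `i`-th face map `X^T_{n+1} → X^T_n`. -/
def face {n : ℕ} (i : Fin (n + 2)) : T.Simplex (n + 1) → T.Simplex n :=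
  T.act i.succAbove (Fin.strictMono_succAbove i).monotone

/-- The `i`-th degeneracy map `X^T_n → X^T_{n+1}`. -/
def degen {n : ℕ} (i : Fin (n + 1)) : T.Simplex n → T.Simplex (n + 1) :=
  T.act i.predAbove (Fin.predAbove_right_monotone i)

end CutTree

namespace CutTree

/-- The composite face map `d_a d_{a+1} ⋯ d_{a+k-1} : X^T_{n+k} → X^T_n`
(the faces are applied from the largest index down, so this is the composite
`d_a ∘ d_{a+1} ∘ ⋯ ∘ d_{a+k-1}`). -/
def faceSeq (T : CutTree) (a : ℕ) : (k : ℕ) → (n : ℕ) → a ≤ n + 1 →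
    T.Simplex (n + k) → T.Simplex n
  | 0, _, _, σ => σ
  | k + 1, n, h, σ => T.faceSeq a k n h (T.face ⟨a + k, by omega⟩ σ)

end CutTree

namespace CutTree

/-- The layers of a simplex, extended to all natural indices by the empty set. -/
def Simplex.N {T : CutTree} {n : ℕ} (σ : T.Simplex n) (j : ℕ) : Set T.V :=
  if h : j < n + 1 then σ.L ⟨j, h⟩ else ∅

theorem Simplex.N_of_lt {T : CutTree} {n : ℕ} (σ : T.Simplex n) {j : ℕ} (h : j < n + 1) :
    σ.N j = σ.L ⟨j, h⟩ := dif_pos h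

theorem Simplex.N_of_ge {T : CutTree} {n : ℕ} (σ : T.Simplex n) {j : ℕ} (h : n ≤ j) :
    σ.N j = ∅ := by
  unfold Simplex.N
  split_ifs with h'
  · have : j = n := by omega
    subst this
    exact σ.last_eq
  · rfl

theorem Simplex.N_anti {T : CutTree} {n : ℕ} (σ : T.Simplex n) {j k : ℕ} (h : j ≤ k) :
    σ.N k ⊆ σ.N j := by
  by_cases hk : k < n + 1
  · rw [σ.N_of_lt hk, σ.N_of_lt (by omega : j < n + 1)]
    exact σ.antitone h
  · rw [σ.N_of_ge (by omega)]
    exact Set.empty_subset _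

theorem Simplex.N_lowerIn {T : CutTree} {n : ℕ} (σ : T.Simplex n) (j : ℕ) :
    T.IsLowerIn (σ.N 0) (σ.N j) := by
  by_cases hk : j < n + 1
  · rw [σ.N_of_lt hk, σ.N_of_lt (by omega : 0 < n + 1)]
    exact σ.lowerIn _
  · rw [σ.N_of_ge (by omega : n ≤ j)]
    exact ⟨Set.empty_subset _, fun _ _ _ h => h.elim⟩

theorem Simplex.ext_N {T : CutTree} {n : ℕ} {σ τ : T.Simplex n}
    (h : ∀ j, j ≤ n → σ.N j = τ.N j) : σ = τ := by
  ext1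
  funext j
  have := h j (by omega)
  rwa [σ.N_of_lt j.2, τ.N_of_lt j.2] at this

theorem cast_N {T : CutTree} {m n : ℕ} (e : m = n) (h : T.Simplex m = T.Simplex n)
    (σ : T.Simplex m) (j : ℕ) : (cast h σ).N j = σ.N j := by
  subst e
  rfl

theorem face_N {T : CutTree} {n : ℕ} (i : ℕ) (hi : i < n + 2) (σ : T.Simplex (n + 1))
    (j : ℕ) (hj : j ≤ n) :
    (T.face ⟨i, hi⟩ σ).N j =
      σ.N (if j < i then j else j + 1) \ σ.N (if n < i then n else n + 1) := by
  have key : ∀ q (hq : q < n + 1), σ.L (Fin.succAbove ⟨i, hi⟩ ⟨q, hq⟩) =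
      σ.N (if q < i then q else q + 1) := by
    intro q hq
    rw [σ.N_of_lt (by split_ifs <;> omega)]
    congr 1
    ext
    simp only [Fin.succAbove, Fin.lt_def, Fin.val_castSucc]
    split_ifs <;> simp
  rw [Simplex.N_of_lt _ (by omega : j < n + 1)]
  change σ.L _ \ σ.L _ = _
  rw [key]
  congr 1
  exact key n (by omega)

theorem faceSeq_N {T : CutTree} (a k n : ℕ) (h : a ≤ n + 1) (σ : T.Simplex (n + k))
    (j : ℕ) (hj : j ≤ n) :
    (T.faceSeq a k n h σ).N j =
      σ.N (if j < a then j else j + k) \ σ.N (if n < a then n else n + k) := by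
  induction k with
  | zero => simp [faceSeq, σ.N_of_ge (le_refl n)]
  | succ k ih =>
    rw [faceSeq, ih, face_N, face_N]
    · have h1 : (if (if j < a then j else j + k) < a + k then (if j < a then j else j + k)
          else (if j < a then j else j + k) + 1) = if j < a then j else j + (k + 1) := by
        split_ifs <;> omega
      have h2 : (if (if n < a then n else n + k) < a + k then (if n < a then n else n + k)
          else (if n < a then n else n + k) + 1) = if n < a then n else n + (k + 1) := by
        split_ifs <;> omega
      rw [h1, h2]
      have h3 : σ.N (if n + k < a + k then n + k else n + k + 1) ⊆
          σ.N (if n < a then n else n + (k + 1)) := by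
        apply σ.N_anti
        split_ifs <;> omega
      ext v
      have := @h3 v
      simp only [Set.mem_diff]
      tauto
    · split_ifs <;> omega
    · split_ifs <;> omega

end CutTree

/-- For every `n ≥ 3` and `0 < i < n - 1`, the square
```
X^T_n    --d_1⋯d_i-->      X^T_{n-i}
 |d_{i+2}⋯d_n                 |d_2⋯d_{n-i}
 v                            v
X^T_{i+1} --d_1⋯d_i-->     X^T_1
```
is a pullback of sets: the canonical comparison map to the fibre product is
injective and hits every compatible pair. -/
theorem dk_pullback (T : CutTree) (n i : ℕ) (hn : 3 ≤ n) (hi0 : 0 < i)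
    (hi : i < n - 1) :
    let top : T.Simplex n → T.Simplex (n - i) := fun σ =>
      T.faceSeq 1 i (n - i) (by omega) (cast (congrArg T.Simplex (by omega)) σ)
    let left : T.Simplex n → T.Simplex (i + 1) := fun σ =>
      T.faceSeq (i + 2) (n - (i + 1)) (i + 1) (by omega)
        (cast (congrArg T.Simplex (by omega)) σ)
    let right : T.Simplex (n - i) → T.Simplex 1 := fun x =>
      T.faceSeq 2 (n - i - 1) 1 (by omega) (cast (congrArg T.Simplex (by omega)) x)
    let bottom : T.Simplex (i + 1) → T.Simplex 1 := fun y =>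
      T.faceSeq 1 i 1 (by omega) (cast (congrArg T.Simplex (by omega)) y)
    Function.Injective (fun σ : T.Simplex n => (top σ, left σ)) ∧
      ∀ (x : T.Simplex (n - i)) (y : T.Simplex (i + 1)),
        right x = bottom y → ∃ σ : T.Simplex n, top σ = x ∧ left σ = y := by
  intro top left right bottom
  have htop : ∀ σ j, j ≤ n - i → (top σ).N j = σ.N (if j < 1 then j else j + i) := by
    intro σ j hj
    simp only [top]
    rw [CutTree.faceSeq_N _ _ _ _ _ _ hj, CutTree.cast_N (by omega), CutTree.cast_N (by omega),
      if_neg (by omega : ¬ n - i < 1), σ.N_of_ge (by omega : n ≤ n - i + i), Set.diff_empty]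
  have hleft : ∀ σ j, j ≤ i + 1 → (left σ).N j = σ.N j \ σ.N (i + 1) := by
    intro σ j hj
    simp only [left]
    rw [CutTree.faceSeq_N _ _ _ _ _ _ hj, CutTree.cast_N (by omega), CutTree.cast_N (by omega),
      if_pos (by omega), if_pos (by omega)]
  have hright : ∀ x, (right x).N 0 = x.N 0 \ x.N 1 := by
    intro x
    simp only [right]
    rw [CutTree.faceSeq_N _ _ _ _ _ _ (by omega), CutTree.cast_N (by omega),
      CutTree.cast_N (by omega), if_pos (by omega), if_pos (by omega)]
  have hbottom : ∀ y, (bottom y).N 0 = y.N 0 := by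
    intro y
    simp only [bottom]
    rw [CutTree.faceSeq_N _ _ _ _ _ _ (by omega), CutTree.cast_N (by omega),
      CutTree.cast_N (by omega), if_pos (by omega), if_neg (by omega),
      y.N_of_ge (by omega : i + 1 ≤ 1 + i), Set.diff_empty]
  constructor
  · intro σ τ hst
    have ht : top σ = top τ := congrArg Prod.fst hst
    have hl : left σ = left τ := congrArg Prod.snd hst
    have hbig : ∀ j, i + 1 ≤ j → j ≤ n → σ.N j = τ.N j := by
      intro j h1 h2
      have := congrArg (fun s => s.N (j - i)) ht
      rwa [htop _ _ (by omega), htop _ _ (by omega), if_neg (by omega),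
        Nat.sub_add_cancel (by omega)] at this
    apply CutTree.Simplex.ext_N
    intro j hj
    by_cases hji : i + 1 ≤ j
    · exact hbig j hji hj
    · have := congrArg (fun s => s.N j) hl
      rw [hleft _ _ (by omega), hleft _ _ (by omega), hbig (i + 1) le_rfl (by omega)] at this
      rw [← Set.diff_union_of_subset (τ.N_anti (by omega : j ≤ i + 1)), ← this,
        Set.diff_union_of_subset]
      rw [← hbig (i + 1) le_rfl (by omega)]
      exact σ.N_anti (by omega)
  · intro x y hxy
    have h0 : x.N 0 \ x.N 1 = y.N 0 := by rw [← hright, hxy, hbottom]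
    have hx10 : x.N 1 ⊆ x.N 0 := x.N_anti (by omega)
    have hyx : ∀ j, y.N j ⊆ x.N 0 \ x.N 1 := fun j => h0 ▸ y.N_anti (Nat.zero_le j)
    let M : ℕ → Set T.V := fun j => if j ≤ i then y.N j ∪ x.N 1 else x.N (j - i)
    have hM0 : M 0 = x.N 0 := by
      simp only [M]
      rw [if_pos (by omega), ← h0, Set.diff_union_of_subset hx10]
    have hMlow : ∀ j, T.IsLowerIn (M 0) (M j) := by
      intro j
      rw [hM0]
      simp only [M]
      split_ifs with hj
      · refine ⟨Set.union_subset ((hyx j).trans Set.diff_subset) hx10, ?_⟩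
        rintro a b ha (hb | hb) hab
        · by_cases ha1 : a ∈ x.N 1
          · exact Or.inr ha1
          · exact Or.inl ((y.N_lowerIn j).2 (h0 ▸ ⟨ha, ha1⟩) hb hab)
        · exact Or.inr ((x.N_lowerIn 1).2 ha hb hab)
      · exact x.N_lowerIn _
    have hManti : ∀ j k, j ≤ k → M k ⊆ M j := by
      intro j k hjk
      simp only [M]
      split_ifs with h1 h2 h2
      · exact Set.union_subset_union_left _ (y.N_anti hjk)
      · omega
      · exact (x.N_anti (by omega)).trans Set.subset_union_right
      · exact x.N_anti (by omega)
    let σ : T.Simplex n :=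
      { L := fun j => M j
        admissible := by
          change T.IsAdmissible (M 0)
          rw [hM0, x.N_of_lt (by omega)]
          exact x.admissible
        antitone := fun j k hjk => hManti j k hjk
        lowerIn := fun j => hMlow j
        last_eq := by
          change M n = ∅
          simp only [M]
          rw [if_neg (by omega), x.N_of_ge le_rfl] }
    have hσ : ∀ j, j ≤ n → σ.N j = M j := fun j hj => σ.N_of_lt (by omega)
    refine ⟨σ, CutTree.Simplex.ext_N ?_, CutTree.Simplex.ext_N ?_⟩
    · intro j hj
      rw [htop _ _ hj, hσ _ (by split_ifs <;> omega)]
      split_ifs with h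
      · have : j = 0 := by omega
        rw [this, hM0]
      · simp only [M]
        rw [if_neg (by omega), Nat.add_sub_cancel]
    · intro j hj
      rw [hleft _ _ hj, hσ _ (by omega), hσ _ (by omega)]
      have e : M (i + 1) = x.N 1 := by
        simp only [M]
        rw [if_neg (by omega), Nat.add_sub_cancel_left]
      rw [e]
      by_cases hji : j ≤ i
      · simp only [M]
        rw [if_pos hji]
        ext v
        have := @hyx j v
        simp only [Set.mem_diff, Set.mem_union] at this ⊢
        tauto
      · have : j = i + 1 := by omega
        rw [this, e, Set.diff_self, y.N_of_ge le_rfl]
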